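/- Let μ¹, μ² be probability measures on ℝ^d supported in B(0,R), ψ L-Lipschitz non-increasing with ψ(0)=1, and F[μ](x) = ∫ ψ(|x−y|)(y−x) dμ(y). Let T be a transport map with T#μ¹ = μ², and set u := ∫ |y − T(y)| dμ¹(y). Then for any x ∈ B(0,R), |F[μ¹](x) − F[μ²](T(x))| ≤ (2RL + 1)(|x − T(x)| + u). -/

import Mathlib

open MeasureTheory Metric

/-- The (topological) support of a measure. -/
def msupport {E : Type*} [TopologicalSpace E] [MeasurableSpace E]
    (μ : MeasureTheory.Measure E) : Set E :=
  {x | ∀ U ∈ nhds x, μ U ≠ 0}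

/-- Symmetric Hegselmann–Krause alignment field. -/
noncomputable def hkField (d : ℕ) (ψ : ℝ → ℝ)
    (μ : MeasureTheory.Measure (EuclideanSpace ℝ (Fin d)))
    (x : EuclideanSpace ℝ (Fin d)) : EuclideanSpace ℝ (Fin d) :=
  ∫ y, ψ ‖x - y‖ • (y - x) ∂μ

theorem ae_mem_of_msupport_subset {E : Type*} [TopologicalSpace E]
    [SecondCountableTopology E] [MeasurableSpace E] {μ : Measure E} {s : Set E}
    (hs : msupport μ ⊆ s) : ∀ᵐ y ∂μ, y ∈ s := by
  rw [ae_iff]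
  refine measure_null_of_locally_null _ fun x hx => ?_
  have hx' : x ∉ msupport μ := fun h => hx (hs h)
  simp only [msupport, Set.mem_ofPred_eq, not_forall, not_not] at hx'
  obtain ⟨U, hU, hU0⟩ := hx'
  exact ⟨U, mem_nhdsWithin_of_mem_nhds hU, hU0⟩

theorem norm_smul_sub_smul_le {E : Type*} [NormedAddCommGroup E] [NormedSpace ℝ E]
    {ψ : ℝ → ℝ} {L D : ℝ} (hL : 0 ≤ L)
    (hψLip : ∀ r₁ r₂ : ℝ, |ψ r₁ - ψ r₂| ≤ L * |r₁ - r₂|)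
    (hψ1 : ∀ r, 0 ≤ r → |ψ r| ≤ 1) {x y x' y' : E} (hxy : ‖y - x‖ ≤ D) :
    ‖ψ ‖x - y‖ • (y - x) - ψ ‖x' - y'‖ • (y' - x')‖ ≤
      (D * L + 1) * (‖x - x'‖ + ‖y - y'‖) := by
  have hdist : |‖x - y‖ - ‖x' - y'‖| ≤ ‖x - x'‖ + ‖y - y'‖ := by
    refine (abs_norm_sub_norm_le _ _).trans ?_
    rw [show x - y - (x' - y') = (x - x') - (y - y') by abel]
    exact norm_sub_le _ _
  have hψ : |ψ ‖x - y‖ - ψ ‖x' - y'‖| ≤ L * (‖x - x'‖ + ‖y - y'‖) :=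
    (hψLip _ _).trans (by gcongr)
  have hdecomp : ψ ‖x - y‖ • (y - x) - ψ ‖x' - y'‖ • (y' - x') =
      (ψ ‖x - y‖ - ψ ‖x' - y'‖) • (y - x) +
        ψ ‖x' - y'‖ • ((y - y') - (x - x')) := by
    module
  rw [hdecomp]
  calc _ ≤ |ψ ‖x - y‖ - ψ ‖x' - y'‖| * ‖y - x‖ +
        |ψ ‖x' - y'‖| * ‖(y - y') - (x - x')‖ := by
          refine (norm_add_le _ _).trans ?_
          rw [norm_smul, norm_smul, Real.norm_eq_abs, Real.norm_eq_abs]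
    _ ≤ L * (‖x - x'‖ + ‖y - y'‖) * D + 1 * (‖y - y'‖ + ‖x - x'‖) := by
          gcongr
          · exact hψ1 _ (norm_nonneg _)
          · exact norm_sub_le _ _
    _ = _ := by ring

theorem integrable_smul_sub {E : Type*} [NormedAddCommGroup E] [NormedSpace ℝ E]
    [SecondCountableTopology E] [MeasurableSpace E] [BorelSpace E]
    {μ : Measure E} [IsFiniteMeasure μ] {R : ℝ} (hμ : ∀ᵐ y ∂μ, y ∈ closedBall (0 : E) R)
    {ψ : ℝ → ℝ} (hψ : Continuous ψ) (hψ1 : ∀ r, 0 ≤ r → |ψ r| ≤ 1) (x : E) :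
    Integrable (fun y => ψ ‖x - y‖ • (y - x)) μ := by
  have hcont : Continuous fun y : E => ψ ‖x - y‖ • (y - x) := by fun_prop
  refine Integrable.of_bound hcont.aestronglyMeasurable (R + ‖x‖) ?_
  filter_upwards [hμ] with y hy
  rw [mem_closedBall_zero_iff] at hy
  rw [norm_smul, Real.norm_eq_abs]
  calc _ ≤ 1 * ‖y - x‖ := by gcongr; exact hψ1 _ (norm_nonneg _)
    _ ≤ R + ‖x‖ := by linarith [norm_sub_le y x]

theorem stmt14 (d : ℕ) (R L : ℝ) (hR : 0 < R) (hL : 0 ≤ L)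
    (ψ : ℝ → ℝ)
    (hψLip : ∀ r₁ r₂ : ℝ, |ψ r₁ - ψ r₂| ≤ L * |r₁ - r₂|)
    (hψmono : ∀ r₁ r₂, (0:ℝ) ≤ r₁ → r₁ ≤ r₂ → ψ r₂ ≤ ψ r₁)
    (hψpos : ∀ r ≥ (0:ℝ), 0 < ψ r) (hψ0 : ψ 0 = 1)
    (μ₁ μ₂ : Measure (EuclideanSpace ℝ (Fin d)))
    [IsProbabilityMeasure μ₁] [IsProbabilityMeasure μ₂]
    (hμ₁ : msupport μ₁ ⊆ closedBall (0 : EuclideanSpace ℝ (Fin d)) R)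
    (hμ₂ : msupport μ₂ ⊆ closedBall (0 : EuclideanSpace ℝ (Fin d)) R)
    (T : EuclideanSpace ℝ (Fin d) → EuclideanSpace ℝ (Fin d))
    (hT : Measurable T) (hTpush : μ₁.map T = μ₂) :
    ∀ x ∈ closedBall (0 : EuclideanSpace ℝ (Fin d)) R,
      ‖hkField d ψ μ₁ x - hkField d ψ μ₂ (T x)‖ ≤
        (2 * R * L + 1) * (‖x - T x‖ + ∫ y, ‖y - T y‖ ∂μ₁) := by
  intro x hx
  have hψ1 : ∀ r, 0 ≤ r → |ψ r| ≤ 1 := fun r hr => by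
    rw [abs_of_pos (hψpos r hr), ← hψ0]
    exact hψmono 0 r le_rfl hr
  have hψcont : Continuous ψ :=
    (LipschitzWith.of_dist_le_mul (K := ⟨L, hL⟩) fun a b => hψLip a b).continuous
  have h₁ := ae_mem_of_msupport_subset hμ₁
  have h₂ := ae_mem_of_msupport_subset hμ₂
  have hint₁ := integrable_smul_sub h₁ hψcont hψ1 x
  have hint₂ := integrable_smul_sub h₂ hψcont hψ1 (T x)
  subst hTpush
  have hT₂ : ∀ᵐ y ∂μ₁, T y ∈ closedBall (0 : EuclideanSpace ℝ (Fin d)) R :=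
    ae_of_ae_map hT.aemeasurable h₂
  have hdisp : Integrable (fun y => ‖y - T y‖) μ₁ := by
    refine Integrable.norm (Integrable.of_bound
      (measurable_id.sub hT).aestronglyMeasurable (R + R) ?_)
    filter_upwards [h₁, hT₂] with y hy hTy
    rw [mem_closedBall_zero_iff] at hy hTy
    exact (norm_sub_le _ _).trans (add_le_add hy hTy)
  have hint₂T : Integrable (fun y => ψ ‖T x - T y‖ • (T y - T x)) μ₁ :=
    hint₂.comp_measurable hT
  unfold hkField
  rw [integral_map hT.aemeasurable hint₂.aestronglyMeasurable,
    ← integral_sub hint₁ hint₂T]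
  calc _ ≤ ∫ y, (2 * R * L + 1) * (‖x - T x‖ + ‖y - T y‖) ∂μ₁ := by
        refine norm_integral_le_of_norm_le
          (((integrable_const _).add hdisp).const_mul _) ?_
        filter_upwards [h₁] with y hy
        rw [mem_closedBall_zero_iff] at hx hy
        exact norm_smul_sub_smul_le hL hψLip hψ1 (by linarith [norm_sub_le y x])
    _ = _ := by
        rw [integral_const_mul, integral_add (integrable_const _) hdisp]
        simp
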